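/- arXiv:1707.06206 — 5 statements merged into one kernel-verified Lean document; each statement's English description precedes it below -/
import Mathlib

section
/- Let Q be an RCC loop, i.e., a loop satisfying (x·y)·z = (x·z)·(z\(y·z)) for all x,y,z ∈ Q. Then (i) the middle nucleus equals the right nucleus: N_μ(Q) = N_ρ(Q); and (ii) the commutant is contained in the left nucleus: C(Q) ⊆ N_λ(Q). -/
/-- In an RCC loop `Q` (one satisfying `(x·y)·z = (x·z)·(z\(y·z))`),
(i) the middle nucleus equals the right nucleus, and
(ii) the commutant is contained in the left nucleus. -/
theorem stmt_3 {Q : Type*} (mul ld : Q → Q → Q) (one : Q)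
    (hone : ∀ x, mul one x = x ∧ mul x one = x)
    (hld : ∀ a b, mul a (ld a b) = b) (hld' : ∀ a b, ld a (mul a b) = b)
    (hR : ∀ x, Function.Bijective fun y => mul y x)
    (hrcc : ∀ x y z, mul (mul x y) z = mul (mul x z) (ld z (mul y z))) :
    ({a | ∀ x y, mul x (mul a y) = mul (mul x a) y} =
      {a | ∀ x y, mul x (mul y a) = mul (mul x y) a}) ∧
    {a | ∀ x, mul x a = mul a x} ⊆
      {a | ∀ x y, mul a (mul x y) = mul (mul a x) y} := by
  refine ⟨Set.ext fun a => ⟨fun ha x y => ?_, fun ha x y => ?_⟩, fun a ha x y => ?_⟩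
  · rw [hrcc x y a, ← ha, hld]
  · obtain ⟨z, hz : mul z a = mul a y⟩ := (hR a).2 (mul a y)
    rw [← hz, ha, hrcc x z a, hz, hld']
  · rw [← ha (mul x y), hrcc x y a, ha y, hld', ha x]
end

section
/- Let q be a prime power and f(x) = x² − r x + s ∈ F_q[x] a monic irreducible quadratic. If A, B ∈ GL(2, F_q) both have characteristic polynomial f and A ≠ B, then 1 is not an eigenvalue of A B⁻¹; equivalently, A B⁻¹ − I is invertible, i.e., the linear map v ↦ v·A·B⁻¹ on row vectors has no nonzero fixed vector. -/
open Polynomial Matrix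

/-- The monic quadratic `x² - r x + s`, when irreducible, takes no zero values. -/
lemma quadratic_ne_zero_of_irreducible {K : Type*} [Field K] {r s : K}
    (hf : Irreducible (X ^ 2 - C r * X + C s : K[X])) (l : K) :
    l ^ 2 - r * l + s ≠ 0 := by
  intro hl
  have hd : (X ^ 2 - C r * X + C s : K[X]).natDegree = 2 := by compute_degree!
  have h1 : (X ^ 2 - C r * X + C s : K[X]).natDegree = 1 := natDegree_eq_of_degree_eq_some
    (degree_eq_one_of_irreducible_of_root hf (x := l) (by simpa [IsRoot] using hl))
  rw [hd] at h1
  exact absurd h1 (by decide)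

/-- Cayley-Hamilton for a matrix with characteristic polynomial `x² - r x + s`, applied to
a row vector. -/
lemma vecMul_vecMul_of_charpoly_eq {K n : Type*} [Field K] [Fintype n] [DecidableEq n]
    {r s : K} {A : Matrix n n K} (hA : A.charpoly = X ^ 2 - C r * X + C s) (v : n → K) :
    (v ᵥ* A) ᵥ* A = r • (v ᵥ* A) - s • v := by
  have h := A.aeval_self_charpoly
  rw [hA] at h
  simp only [map_add, map_sub, map_mul, map_pow, aeval_X, aeval_C,
    Algebra.algebraMap_eq_smul_one, smul_mul_assoc, one_mul] at h
  have h2 : A * A = r • A - s • (1 : Matrix n n K) := by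
    rw [← sub_eq_zero, ← h]
    noncomm_ring
  rw [vecMul_vecMul, h2, vecMul_sub, vecMul_smul, vecMul_smul, vecMul_one]

/-- A matrix with irreducible quadratic characteristic polynomial has no row eigenvector. -/
lemma vecMul_ne_smul_of_irreducible {K n : Type*} [Field K] [Fintype n] [DecidableEq n]
    {r s : K} (hf : Irreducible (X ^ 2 - C r * X + C s : K[X])) {A : Matrix n n K}
    (hA : A.charpoly = X ^ 2 - C r * X + C s) {v : n → K} (hv : v ≠ 0) (l : K) :
    v ᵥ* A ≠ l • v := by
  intro h
  have h2 := vecMul_vecMul_of_charpoly_eq hA v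
  rw [h, smul_vecMul, h] at h2
  have h3 : (l ^ 2 - r * l + s) • v = 0 := by
    rw [← sub_eq_zero] at h2
    rw [← h2]
    module
  exact (smul_eq_zero.mp h3).elim (quadratic_ne_zero_of_irreducible hf l) hv

/-- Two `2×2` matrices with the same irreducible characteristic polynomial that agree on a
nonzero row vector are equal. -/
lemma eq_of_vecMul_eq_of_irreducible {K : Type*} [Field K] {r s : K}
    (hf : Irreducible (X ^ 2 - C r * X + C s : K[X])) {A B : Matrix (Fin 2) (Fin 2) K}
    (hA : A.charpoly = X ^ 2 - C r * X + C s) (hB : B.charpoly = X ^ 2 - C r * X + C s)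
    {v : Fin 2 → K} (hv : v ≠ 0) (h : v ᵥ* A = v ᵥ* B) : A = B := by
  have hli : LinearIndependent K ![v, v ᵥ* A] :=
    (LinearIndependent.pair_iff' hv).mpr fun l hl =>
      vecMul_ne_smul_of_irreducible hf hA hv l hl.symm
  have hw : (v ᵥ* A) ᵥ* A = (v ᵥ* A) ᵥ* B := by
    rw [vecMul_vecMul_of_charpoly_eq hA, h, vecMul_vecMul_of_charpoly_eq hB]
  have hP : IsUnit (of ![v, v ᵥ* A]) := linearIndependent_rows_iff_isUnit.mp hli
  refine hP.mul_left_cancel ?_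
  ext i j
  fin_cases i
  · exact congrFun h j
  · exact congrFun hw j

/-- If `A ≠ B` are `2×2` matrices over `F_q` both having the monic
irreducible characteristic polynomial `f(x) = x² - r x + s`, then `1` is not an
eigenvalue of `A B⁻¹`: `A B⁻¹ - I` is invertible, i.e. the map `v ↦ v · (A B⁻¹)` on
row vectors fixes no nonzero vector. -/
theorem stmt_5 {K : Type*} [Field K] [Fintype K] (r s : K)
    (hf : Irreducible (X ^ 2 - C r * X + C s : K[X]))
    (A B : Matrix (Fin 2) (Fin 2) K)
    (hA : A.charpoly = X ^ 2 - C r * X + C s)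
    (hB : B.charpoly = X ^ 2 - C r * X + C s)
    (hAB : A ≠ B) :
    IsUnit (A * B⁻¹ - 1) ∧
      ∀ v : Fin 2 → K, v ≠ 0 → Matrix.vecMul v (A * B⁻¹) ≠ v := by
  have hs : s ≠ 0 := by simpa using quadratic_ne_zero_of_irreducible hf 0
  have hdet : IsUnit B.det := by
    have h : B.det = s := by simp [det_eq_sign_charpoly_coeff, hB]
    exact h ▸ hs.isUnit
  have hfix : ∀ v : Fin 2 → K, v ≠ 0 → v ᵥ* (A * B⁻¹) ≠ v := by
    intro v hv h
    refine hAB (eq_of_vecMul_eq_of_irreducible hf hA hB hv ?_)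
    rw [← nonsing_inv_mul_cancel_right B A hdet, ← vecMul_vecMul, h]
  refine ⟨?_, hfix⟩
  rw [isUnit_iff_isUnit_det, isUnit_iff_ne_zero]
  intro h0
  obtain ⟨v, hv, h⟩ := exists_vecMul_eq_zero_iff.mpr h0
  rw [vecMul_sub, vecMul_one, sub_eq_zero] at h
  exact hfix v hv h
end

section
/- Let q be a prime power and f(x) = x² − r x + s ∈ F_q[x] a monic irreducible quadratic. Then (Q, ∘_f) is a loop with identity element (0,1): the element (0,1) satisfies (0,1) ∘_f v = v ∘_f (0,1) = v for all v ∈ Q, and for every v ∈ Q both maps w ↦ w ∘_f v and w ↦ v ∘_f w are bijections of Q. -/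
open Polynomial Matrix
open scoped Classical

/-- The right-translation matrix `M_{(c,d)}` of the Hall-type construction:
`M_{(0,d)} = d·I` and, for `c ≠ 0`, `M_{(c,d)}` has rows `(r - d, f(d)/(-c))` and
`(c, d)`, where `f(x) = x² - r x + s`. -/
noncomputable def Mmat {K : Type*} [Field K] (r s c d : K) : Matrix (Fin 2) (Fin 2) K :=
  if c = 0 then d • (1 : Matrix (Fin 2) (Fin 2) K)
  else !![r - d, (d ^ 2 - r * d + s) / (-c); c, d]

/-- The binary operation `v ∘_f w = v · M_{(w 0, w 1)}` on row vectors. -/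
noncomputable def lmul {K : Type*} [Field K] (r s : K) (v w : Fin 2 → K) : Fin 2 → K :=
  Matrix.vecMul v (Mmat r s (w 0) (w 1))

/-- The quadratic is nonzero at every point of the field, being irreducible of degree two. -/
theorem eval_ne_zero_of_irreducible_quadratic {K : Type*} [Field K] {r s : K}
    (hf : Irreducible (X ^ 2 - C r * X + C s : K[X])) (x : K) : x ^ 2 - r * x + s ≠ 0 := by
  intro hx
  have hdeg : (X ^ 2 - C r * X + C s : K[X]).degree = 2 := by compute_degree!
  have hroot : (X ^ 2 - C r * X + C s : K[X]).IsRoot x := by simpa [IsRoot.def] using hx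
  have h := degree_eq_one_of_irreducible_of_root hf hroot
  rw [hdeg] at h
  exact absurd h (by decide)

theorem Mmat_zero {K : Type*} [Field K] (r s d : K) :
    Mmat r s 0 d = !![d, 0; 0, d] := by
  ext i j
  fin_cases i <;> fin_cases j <;> simp [Mmat]

theorem Mmat_of_ne_zero {K : Type*} [Field K] (r s d : K) {c : K} (hc : c ≠ 0) :
    Mmat r s c d = !![r - d, (d ^ 2 - r * d + s) / (-c); c, d] :=
  if_neg hc

theorem det_Mmat {K : Type*} [Field K] (r s d : K) {c : K} (hc : c ≠ 0) :
    (Mmat r s c d).det = s := by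
  rw [Mmat_of_ne_zero r s d hc, det_fin_two_of]
  field_simp
  ring

theorem lmul_of_eq_zero {K : Type*} [Field K] (r s : K) (v : Fin 2 → K) {w : Fin 2 → K}
    (hw : w 0 = 0) : lmul r s v w = ![v 0 * w 1, v 1 * w 1] := by
  rw [lmul, hw, Mmat_zero]
  ext i
  fin_cases i <;> simp [vecMul, dotProduct, Fin.sum_univ_two]

theorem lmul_of_ne_zero {K : Type*} [Field K] (r s : K) (v : Fin 2 → K) {w : Fin 2 → K}
    (hw : w 0 ≠ 0) :
    lmul r s v w = ![v 0 * (r - w 1) + v 1 * w 0,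
      v 0 * ((w 1 ^ 2 - r * w 1 + s) / (-(w 0))) + v 1 * w 1] := by
  rw [lmul, Mmat_of_ne_zero r s _ hw]
  ext i
  fin_cases i <;> simp [vecMul, dotProduct, Fin.sum_univ_two]

/-- Right translation by a nonzero vector is injective. -/
theorem lmul_left_injective {K : Type*} [Field K] {r s : K} (hs : s ≠ 0) {v : Fin 2 → K}
    (hv : v ≠ 0) : Function.Injective fun w => lmul r s w v := by
  refine vecMul_injective_of_isUnit ((isUnit_iff_isUnit_det _).2 (isUnit_iff_ne_zero.2 ?_))
  by_cases h0 : v 0 = 0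
  · have h1 : v 1 ≠ 0 := fun h1 => hv (by ext i; fin_cases i <;> simp [h0, h1])
    simp [h0, Mmat_zero, det_fin_two_of, h1]
  · rwa [det_Mmat r s _ h0]

/-- If `w 0 ≠ 0`, the wedge of `v` with `v ∘_f w` determines `w 0` in terms of the first
coordinate of `v ∘_f w`. -/
theorem wedge_lmul {K : Type*} [Field K] (r s : K) {v w : Fin 2 → K} (hw : w 0 ≠ 0)
    (hv : v 0 ≠ 0) :
    (v 1 * lmul r s v w 0 - v 0 * lmul r s v w 1) * w 0 =
      v 0 ^ 2 * ((lmul r s v w 0 / v 0) ^ 2 - r * (lmul r s v w 0 / v 0) + s) := by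
  rw [lmul_of_ne_zero r s v hw]
  simp only [cons_val_zero, cons_val_one]
  field_simp
  ring

/-- Left translation by a nonzero vector is injective. -/
theorem lmul_right_injective {K : Type*} [Field K] {r s : K}
    (hf : ∀ x : K, x ^ 2 - r * x + s ≠ 0) {v : Fin 2 → K} (hv : v ≠ 0) :
    Function.Injective fun w => lmul r s v w := by
  have ext_two {a b : Fin 2 → K} (h0 : a 0 = b 0) (h1 : a 1 = b 1) : a = b := by
    ext i; fin_cases i <;> assumption
  intro w w' h
  replace h : lmul r s v w = lmul r s v w' := h
  by_cases hv0 : v 0 = 0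
  · have hv1 : v 1 ≠ 0 := fun h1 => hv (ext_two hv0 h1)
    have key (u : Fin 2 → K) : lmul r s v u = v 1 • u := by
      by_cases hu : u 0 = 0
      · rw [lmul_of_eq_zero r s v hu]
        exact ext_two (by simp [hv0, hu]) (by simp)
      · rw [lmul_of_ne_zero r s v hu]
        exact ext_two (by simp [hv0]) (by simp [hv0])
    rw [key, key] at h
    exact smul_right_injective _ hv1 h
  · have wedge_eq_zero {u : Fin 2 → K} (hu : u 0 = 0) :
        v 1 * lmul r s v u 0 - v 0 * lmul r s v u 1 = 0 := by
      rw [lmul_of_eq_zero r s v hu]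
      simp only [cons_val_zero, cons_val_one]
      ring
    have wedge_ne_zero {u : Fin 2 → K} (hu : u 0 ≠ 0) :
        v 1 * lmul r s v u 0 - v 0 * lmul r s v u 1 ≠ 0 := fun h0 => by
      have := wedge_lmul r s hu hv0
      rw [h0, zero_mul] at this
      exact mul_ne_zero (pow_ne_zero 2 hv0) (hf _) this.symm
    by_cases hw : w 0 = 0
    · have hw' : w' 0 = 0 := by
        by_contra hw'
        exact wedge_ne_zero hw' (h ▸ wedge_eq_zero hw)
      have h0 := congrFun h 0
      rw [lmul_of_eq_zero r s v hw, lmul_of_eq_zero r s v hw'] at h0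
      exact ext_two (hw.trans hw'.symm) (mul_left_cancel₀ hv0 (by simpa using h0))
    · have hw' : w' 0 ≠ 0 := fun hw' => wedge_ne_zero hw (h ▸ wedge_eq_zero hw')
      have hc : w 0 = w' 0 := by
        have h1 := wedge_lmul r s hw hv0
        rw [h, ← wedge_lmul r s hw' hv0] at h1
        exact mul_left_cancel₀ (wedge_ne_zero hw') h1
      have h0 := congrFun h 0
      rw [lmul_of_ne_zero r s v hw, lmul_of_ne_zero r s v hw', hc] at h0
      simp only [cons_val_zero] at h0
      exact ext_two hc (sub_right_injective (mul_left_cancel₀ hv0 (add_right_cancel h0)))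

/-- An injective self-map of a finite type fixing `0` permutes the nonzero elements. -/
theorem Function.Injective.bijOn_ne_zero {α : Type*} [Finite α] [Zero α] {g : α → α}
    (hg : Function.Injective g) (h0 : g 0 = 0) : Set.BijOn g {a | a ≠ 0} {a | a ≠ 0} := by
  refine ⟨fun a ha => ?_, hg.injOn, fun b hb => ?_⟩
  · exact fun h => ha (hg (h.trans h0.symm))
  · obtain ⟨a, rfl⟩ := Finite.surjective_of_injective hg b
    exact ⟨a, fun ha => hb (by rw [ha, h0]), rfl⟩

/-- `(Q, ∘_f)` with `Q = F_q² \ {0}` is a loop with identity `(0,1)`: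
`(0,1)` is a two-sided identity, and for each `v ∈ Q` both the right translation
`w ↦ w ∘_f v` and the left translation `w ↦ v ∘_f w` are bijections of `Q`. -/
theorem stmt_6 {K : Type*} [Field K] [Fintype K] (r s : K)
    (hf : Irreducible (X ^ 2 - C r * X + C s : K[X])) :
    (∀ v : Fin 2 → K, v ≠ 0 → lmul r s ![0, 1] v = v ∧ lmul r s v ![0, 1] = v) ∧
    (∀ v : Fin 2 → K, v ≠ 0 →
        Set.BijOn (fun w => lmul r s w v) {w : Fin 2 → K | w ≠ 0} {w : Fin 2 → K | w ≠ 0}) ∧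
    (∀ v : Fin 2 → K, v ≠ 0 →
        Set.BijOn (fun w => lmul r s v w) {w : Fin 2 → K | w ≠ 0} {w : Fin 2 → K | w ≠ 0}) := by
  have hne := eval_ne_zero_of_irreducible_quadratic hf
  have hs : s ≠ 0 := by simpa using hne 0
  refine ⟨fun v _ => ⟨?_, ?_⟩, fun v hv => ?_, fun v hv => ?_⟩
  · by_cases h : v 0 = 0
    · rw [lmul_of_eq_zero r s _ h]
      ext i
      fin_cases i <;> simp [h]
    · rw [lmul_of_ne_zero r s _ h]
      ext i
      fin_cases i <;> simp
  · rw [lmul_of_eq_zero r s v rfl]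
    ext i
    fin_cases i <;> simp
  · exact (lmul_left_injective hs hv).bijOn_ne_zero (zero_vecMul _)
  · refine (lmul_right_injective hne hv).bijOn_ne_zero ?_
    rw [lmul_of_eq_zero r s v rfl]
    simp
end

section
/- Let q be a prime power and f(x) = x² + s ∈ F_q[x] a monic irreducible quadratic (i.e., r = 0). Then the center of the loop (Q, ∘_f) is exactly {(0,1), (0,−1)}; concretely, an element (0,z) of the commutant satisfies (c,d) ∘_f ((a,b) ∘_f (0,z)) = ((c,d) ∘_f (a,b)) ∘_f (0,z) for all (a,b), (c,d) ∈ Q if and only if z = 1 or z = −1. -/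
open Polynomial Matrix
open scoped Classical

theorem lmul_zero_cons {K : Type*} [Field K] (r s z : K) (v : Fin 2 → K) :
    lmul r s v ![0, z] = z • v := by
  simp [lmul, Mmat, Matrix.vecMul_smul]

theorem Mmat_smul_of_sq_eq_one {K : Type*} [Field K] (s z c d : K) (hz : z ^ 2 = 1) :
    Mmat 0 s (z * c) (z * d) = z • Mmat 0 s c d := by
  have hz0 : z ≠ 0 := by rintro rfl; simp at hz
  by_cases hc : c = 0
  · simp [Mmat, hc, mul_smul]
  · ext i j
    fin_cases i <;> fin_cases j <;> simp [Mmat, hc, hz0]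
    field_simp
    linear_combination s * hz

/-- For `f(x) = x² + s` irreducible (the case `r = 0`), the center of
`(Q, ∘_f)` is `{(0,1), (0,-1)}`: a commutant element `(0,z)` (with `z ≠ 0`) satisfies
`(c,d) ∘_f ((a,b) ∘_f (0,z)) = ((c,d) ∘_f (a,b)) ∘_f (0,z)` for all `(a,b), (c,d) ∈ Q`
iff `z = 1` or `z = -1`. -/
theorem stmt_14 {K : Type*} [Field K] [Fintype K] (s : K)
    (hf : Irreducible (X ^ 2 + C s : K[X])) :
    ∀ z : K, z ≠ 0 →
      ((∀ u v : Fin 2 → K, u ≠ 0 → v ≠ 0 →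
          lmul 0 s u (lmul 0 s v ![0, z]) = lmul 0 s (lmul 0 s u v) ![0, z]) ↔
        (z = 1 ∨ z = -1)) := by
  have hs : s ≠ 0 := by
    rintro rfl
    rw [C_0, add_zero] at hf
    exact not_irreducible_pow (by norm_num) hf
  intro z hz
  simp only [lmul_zero_cons]
  rw [← sq_eq_one_iff]
  constructor
  · intro h
    have h1 := congrFun (h ![1, 0] ![1, 0] (by simp) (by simp)) 1
    simp [lmul, Mmat, hz, Matrix.vecMul, dotProduct, Fin.sum_univ_two] at h1
    field_simp at h1
    linear_combination h1
  · intro h u v _ _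
    simp only [lmul, Pi.smul_apply, smul_eq_mul, Mmat_smul_of_sq_eq_one s z _ _ h,
      Matrix.vecMul_smul]
end

section
/- Let q be a prime power and f(x) = x² − r x + s ∈ F_q[x] a monic irreducible quadratic. Set R = {c·I : c ∈ F_q, c ≠ 0} ∪ {M ∈ GL(2,F_q) : tr M = r and det M = s} and H = {2×2 matrices with rows (x, y) and (0, 1) : x ∈ F_q, x ≠ 0, y ∈ F_q} ≤ GL(2,F_q). Then every A ∈ GL(2,F_q) factors as A = B·C with B ∈ R and C ∈ H, R ∩ H = {I}, and this factorization is unique; consequently |GL(2,F_q)| = |R|·|H| = (q² − 1)·q(q − 1). -/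
open Polynomial Matrix

/-- An irreducible monic quadratic over a field has no root. -/
theorem sq_sub_mul_add_ne_zero_of_irreducible {K : Type*} [Field K] {r s : K}
    (hf : Irreducible (X ^ 2 - C r * X + C s : K[X])) (t : K) : t ^ 2 - r * t + s ≠ 0 := by
  intro h
  have hdeg : (X ^ 2 - C r * X + C s : K[X]).degree = 2 := by compute_degree!
  have h1 := degree_eq_one_of_irreducible_of_root hf (x := t) (by simpa [IsRoot] using h)
  rw [hdeg] at h1
  exact absurd h1 (by decide)

/-- A matrix with vanishing lower left entry does not have an irreducible characteristic
polynomial. -/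
theorem apply_one_zero_ne_zero_of_irreducible {K : Type*} [Field K] {r s : K}
    (hf : Irreducible (X ^ 2 - C r * X + C s : K[X])) {M : Matrix (Fin 2) (Fin 2) K}
    (ht : M.trace = r) (hd : M.det = s) : M 1 0 ≠ 0 := by
  intro h
  rw [trace_fin_two] at ht
  rw [det_fin_two] at hd
  apply sq_sub_mul_add_ne_zero_of_irreducible hf (M 1 1)
  rw [← ht, ← hd, h]
  ring

/-- If every unit of a finite monoid factors uniquely as a product of an element of `R` and an
element of `H`, both consisting of units, then the number of units is `|R| * |H|`. -/
theorem card_units_eq_of_existsUnique_mul {M : Type*} [Monoid M] {R H : Set M}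
    (hR : ∀ B ∈ R, IsUnit B) (hH : ∀ C ∈ H, IsUnit C)
    (h : ∀ A : M, IsUnit A → ∃! BC : M × M, BC.1 ∈ R ∧ BC.2 ∈ H ∧ A = BC.1 * BC.2) :
    Nat.card Mˣ = Nat.card R * Nat.card H := by
  rw [← Nat.card_prod]
  symm
  refine Nat.card_eq_of_bijective
    (fun p : R × H => (hR p.1 p.1.2).unit * (hH p.2 p.2.2).unit) ⟨?_, ?_⟩
  · rintro ⟨⟨B, hB⟩, ⟨C, hC⟩⟩ ⟨⟨B', hB'⟩, ⟨C', hC'⟩⟩ hp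
    have hp' : B * C = B' * C' := by simpa using congrArg Units.val hp
    have := (h (B * C) ((hR B hB).mul (hH C hC))).unique (y₁ := (B, C)) (y₂ := (B', C'))
      ⟨hB, hC, rfl⟩ ⟨hB', hC', hp'⟩
    simpa using this
  · intro A
    obtain ⟨⟨B, C⟩, ⟨hB, hC, hA⟩, -⟩ := h A A.isUnit
    exact ⟨(⟨B, hB⟩, ⟨C, hC⟩), Units.ext (by simpa using hA.symm)⟩

/-- With `R` the set of right-translation matrices of `(Q, ∘_f)`
(nonzero scalar matrices together with the invertible matrices of trace `r` and
determinant `s`) and `H` the set of matrices with rows `(x, y)` and `(0, 1)`, `x ≠ 0`: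
every `A ∈ GL(2, F_q)` factors uniquely as `A = B·C` with `B ∈ R`, `C ∈ H`;
`R ∩ H = {I}`; and `|GL(2,F_q)| = |R|·|H| = (q² - 1)·q(q - 1)`. -/
theorem stmt_17 {K : Type*} [Field K] [Fintype K] (r s : K)
    (hf : Irreducible (X ^ 2 - C r * X + C s : K[X])) :
    let R : Set (Matrix (Fin 2) (Fin 2) K) :=
      {M | (∃ c : K, c ≠ 0 ∧ M = c • (1 : Matrix (Fin 2) (Fin 2) K)) ∨
        (IsUnit M ∧ M.trace = r ∧ M.det = s)}
    let H : Set (Matrix (Fin 2) (Fin 2) K) :=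
      {M | ∃ x y : K, x ≠ 0 ∧ M = !![x, y; 0, 1]}
    (∀ A : Matrix (Fin 2) (Fin 2) K, IsUnit A →
        ∃! BC : Matrix (Fin 2) (Fin 2) K × Matrix (Fin 2) (Fin 2) K,
          BC.1 ∈ R ∧ BC.2 ∈ H ∧ A = BC.1 * BC.2) ∧
    R ∩ H = {1} ∧
    Nat.card (Matrix.GeneralLinearGroup (Fin 2) K) = Nat.card R * Nat.card H ∧
    Nat.card R * Nat.card H =
      (Fintype.card K ^ 2 - 1) * (Fintype.card K * (Fintype.card K - 1)) := by
  intro R H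
  have hs : s ≠ 0 := by simpa using sq_sub_mul_add_ne_zero_of_irreducible hf 0
  have hR : ∀ B ∈ R, IsUnit B := by
    rintro B (⟨c, hc, rfl⟩ | ⟨hB, -⟩)
    · rw [isUnit_iff_isUnit_det, isUnit_iff_ne_zero]
      simpa using hc
    · exact hB
  have hH : ∀ B ∈ H, IsUnit B := by
    rintro B ⟨x, y, hx, rfl⟩
    rw [isUnit_iff_isUnit_det, isUnit_iff_ne_zero]
    simpa using hx
  have hfac : ∀ A : Matrix (Fin 2) (Fin 2) K, IsUnit A →
      ∃! BC : Matrix (Fin 2) (Fin 2) K × Matrix (Fin 2) (Fin 2) K,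
        BC.1 ∈ R ∧ BC.2 ∈ H ∧ A = BC.1 * BC.2 := by
    intro A hA
    rw [isUnit_iff_isUnit_det, isUnit_iff_ne_zero] at hA
    refine existsUnique_of_exists_of_unique ?_ ?_
    · obtain ⟨a, b, c, d, rfl⟩ : ∃ a b c d, A = !![a, b; c, d] := ⟨_, _, _, _, eta_fin_two A⟩
      rw [det_fin_two_of] at hA
      by_cases hc : c = 0
      · subst hc
        have had : a * d ≠ 0 := by simpa using hA
        have ha := left_ne_zero_of_mul had
        have hd := right_ne_zero_of_mul had
        refine ⟨(d • 1, !![a / d, b / d; 0, 1]), Or.inl ⟨d, hd, rfl⟩,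
          ⟨_, _, div_ne_zero ha hd, rfl⟩, ?_⟩
        simp [smul_of, mul_div_cancel₀, hd]
      · obtain ⟨x, hx⟩ : ∃ x, x = (a * d - b * c) / s := ⟨_, rfl⟩
        have hx0 : x ≠ 0 := hx ▸ div_ne_zero hA hs
        have hxs : x * s = a * d - b * c := by rw [hx, div_mul_cancel₀ _ hs]
        obtain ⟨y, hy⟩ : ∃ y, y = (d - (r - a / x)) / (c / x) := ⟨_, rfl⟩
        have hy' : c / x * y = d - (r - a / x) := by
          rw [hy, mul_div_cancel₀ _ (div_ne_zero hc hx0)]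
        have hdet : (!![a / x, b - a / x * y; c / x, r - a / x]).det = s := by
          rw [det_fin_two_of]
          apply mul_left_cancel₀ hx0
          rw [hxs]
          have e1 : x * (a / x) = a := mul_div_cancel₀ _ hx0
          have e2 : x * (c / x) = c := mul_div_cancel₀ _ hx0
          linear_combination a * hy' + (r - a / x) * e1 - b * e2 + y * (c / x) * e1
        refine ⟨(!![a / x, b - a / x * y; c / x, r - a / x], !![x, y; 0, 1]),
          Or.inr ⟨?_, by simp [trace_fin_two], hdet⟩, ⟨x, y, hx0, rfl⟩, ?_⟩
        · rw [isUnit_iff_isUnit_det, hdet, isUnit_iff_ne_zero]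
          exact hs
        · simp [hx0, hy']
    · rintro ⟨B, _⟩ ⟨B', _⟩ ⟨hB, ⟨x, y, hx, rfl⟩, h⟩ ⟨hB', ⟨x', y', hx', rfl⟩, h'⟩
      dsimp only at hB h hB' h'
      have e : B * !![x, y; 0, 1] = B' * !![x', y'; 0, 1] := h.symm.trans h'
      have e00 : B 0 0 * x = B' 0 0 * x' := by
        simpa [mul_apply, Fin.sum_univ_two] using congrFun (congrFun e 0) 0
      have e01 : B 0 0 * y + B 0 1 = B' 0 0 * y' + B' 0 1 := by
        simpa [mul_apply, Fin.sum_univ_two] using congrFun (congrFun e 0) 1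
      have e10 : B 1 0 * x = B' 1 0 * x' := by
        simpa [mul_apply, Fin.sum_univ_two] using congrFun (congrFun e 1) 0
      have e11 : B 1 0 * y + B 1 1 = B' 1 0 * y' + B' 1 1 := by
        simpa [mul_apply, Fin.sum_univ_two] using congrFun (congrFun e 1) 1
      have hxy : x = x' ∧ y = y' := by
        rcases hB with ⟨c, hc, rfl⟩ | ⟨-, ht, hd⟩ <;>
          rcases hB' with ⟨c', hc', rfl⟩ | ⟨-, ht', hd'⟩
        · obtain rfl : c = c' := by simpa using e11
          exact ⟨by simpa [hc] using e00, by simpa [hc] using e01⟩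
        · have := apply_one_zero_ne_zero_of_irreducible hf ht' hd'
          simp_all
        · have := apply_one_zero_ne_zero_of_irreducible hf ht hd
          simp_all
        · have h10 := apply_one_zero_ne_zero_of_irreducible hf ht hd
          obtain rfl : x = x' := by
            have hdet := congrArg det e
            rw [det_mul, det_mul, hd, hd', det_fin_two_of, det_fin_two_of] at hdet
            simpa using mul_left_cancel₀ hs hdet
          have h00 := mul_right_cancel₀ hx e00
          have h10' := mul_right_cancel₀ hx e10
          rw [trace_fin_two] at ht ht'
          refine ⟨rfl, mul_left_cancel₀ h10 ?_⟩
          linear_combination e11 - ht + ht' + h00 - y' * h10'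
      obtain ⟨rfl, rfl⟩ := hxy
      rw [(hH _ ⟨x, y, hx, rfl⟩).mul_left_inj] at e
      rw [e]
  refine ⟨hfac, ?_, card_units_eq_of_existsUnique_mul hR hH hfac, ?_⟩
  · ext M
    constructor
    · rintro ⟨⟨c, -, rfl⟩ | ⟨-, ht, hd⟩, x, y, -, hM⟩
      · have hc : c = 1 := by simpa using congrFun (congrFun hM 1) 1
        simp [hc]
      · exact absurd (by simp [hM]) (apply_one_zero_ne_zero_of_irreducible hf ht hd)
    · rintro rfl
      exact ⟨Or.inl ⟨1, one_ne_zero, by simp⟩, 1, 0, one_ne_zero, one_fin_two⟩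
  · rw [← card_units_eq_of_existsUnique_mul hR hH hfac]
    have := card_GL_field (𝔽 := K) 2
    simp only [Fin.prod_univ_two] at this
    refine this.trans ?_
    simp [Nat.mul_sub, sq]
end
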